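/- Let ν ∈ (0,1), let M and b be real numbers with 0 < b < M, let a₁, a₂, a₃ be real numbers, and set f(ν) = (2−ν)·[a₁·M^{1−ν} + a₂·(M+b)^{1−ν}] + a₃·[M^{2−ν} − (M+b)^{2−ν}]. Then: (1) if a₂ < 0 and a₃·b/a₂ ≤ 3/2, then f(ν) < (2−ν)·M^{1−ν}·( a₁ + a₂ − a₃b + Σ_{k=1}^{2} C(1−ν, k)·(a₂ − a₃b/(k+1))·(b/M)^k ) < (2−ν)·M^{1−ν}·(a₁ + a₂ − a₃b), where C(1−ν, k) denotes the generalized binomial coefficient (1−ν)(1−ν−1)⋯(1−ν−k+1)/k!; and (2) if a₃·b = 2a₂ > 0, then f(ν) < (2−ν)·M^{1−ν}·( a₁ + a₂ − a₃b − a₂·(b/M)²·((1−ν)ν/6)·(1 − ((ν+1)/2)·(b/M)) ). -/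

import Mathlib

/-- Generalized binomial coefficient C(s,k) = s(s−1)⋯(s−k+1)/k!. -/
noncomputable def genBinom (s : ℝ) (k : ℕ) : ℝ :=
  (∏ i ∈ Finset.range k, (s - (i : ℝ))) / (Nat.factorial k : ℝ)

/-- A function vanishing at `0` with positive derivative on `(0, ∞)` is positive there. -/
theorem pos_of_hasDerivAt_pos {F F' : ℝ → ℝ} (h0 : F 0 = 0)
    (hd : ∀ x, 0 ≤ x → HasDerivAt F (F' x) x) (hpos : ∀ x, 0 < x → 0 < F' x)
    {x : ℝ} (hx : 0 < x) : 0 < F x := by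
  have hmono : StrictMonoOn F (Set.Ici 0) := by
    refine strictMonoOn_of_deriv_pos (convex_Ici 0)
      (fun y hy => (hd y hy).continuousAt.continuousWithinAt) fun y hy => ?_
    rw [interior_Ici] at hy
    rw [(hd y (le_of_lt hy)).deriv]
    exact hpos y hy
  simpa [h0] using hmono Set.self_mem_Ici hx.le hx

theorem hasDerivAt_one_add_rpow (p : ℝ) {x : ℝ} (hx : 0 ≤ x) :
    HasDerivAt (fun y : ℝ => (1 + y) ^ p) (p * (1 + x) ^ (p - 1)) x := by
  have h := ((hasDerivAt_id x).const_add 1).rpow_const (p := p)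
    (Or.inl (by simp only [id_eq]; positivity))
  simpa using h

theorem hasDerivAt_cubic (c₀ c₁ c₂ c₃ x : ℝ) :
    HasDerivAt (fun y : ℝ => c₀ + c₁ * y + c₂ * y ^ 2 + c₃ * y ^ 3)
      (c₁ + 2 * c₂ * x + 3 * c₃ * x ^ 2) x := by
  have h := ((((hasDerivAt_id' x).const_mul c₁).const_add c₀).add
    ((hasDerivAt_pow 2 x).const_mul c₂)).add ((hasDerivAt_pow 3 x).const_mul c₃)
  exact h.congr_deriv (by push_cast; ring)

/-- Taylor remainder of `(1 + x) ^ s` at `0` after the cubic term with coefficient `e`. -/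
noncomputable def remainderAux (s e x : ℝ) : ℝ :=
  (1 + x) ^ s - (1 + s * x + s * (s - 1) / 2 * x ^ 2 + e * x ^ 3)

/-- The derivative of `remainderAux`. -/
noncomputable def remainderAuxDeriv (s e x : ℝ) : ℝ :=
  s * (1 + x) ^ (s - 1) - (s + s * (s - 1) * x + 3 * e * x ^ 2)

/-- The second derivative of `remainderAux`. -/
noncomputable def remainderAuxDeriv2 (s e x : ℝ) : ℝ :=
  s * (s - 1) * (1 + x) ^ (s - 2) - (s * (s - 1) + 6 * e * x)

/-- The primitive of `remainderAux` vanishing at `0`. -/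
noncomputable def remainderAuxInt (s e x : ℝ) : ℝ :=
  ((1 + x) ^ (s + 1) - 1) / (s + 1)
    - (x + s / 2 * x ^ 2 + s * (s - 1) / 6 * x ^ 3 + e / 4 * x ^ 4)

theorem remainderAux_zero (s e : ℝ) : remainderAux s e 0 = 0 := by simp [remainderAux]

theorem remainderAuxDeriv_zero (s e : ℝ) : remainderAuxDeriv s e 0 = 0 := by
  simp [remainderAuxDeriv]

theorem remainderAuxInt_zero (s e : ℝ) : remainderAuxInt s e 0 = 0 := by
  simp [remainderAuxInt]

theorem hasDerivAt_remainderAux (s e : ℝ) {x : ℝ} (hx : 0 ≤ x) :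
    HasDerivAt (remainderAux s e) (remainderAuxDeriv s e x) x := by
  have h := (hasDerivAt_one_add_rpow s hx).sub (hasDerivAt_cubic 1 s (s * (s - 1) / 2) e x)
  exact h.congr_deriv (by simp only [remainderAuxDeriv]; ring)

theorem hasDerivAt_remainderAuxDeriv (s e : ℝ) {x : ℝ} (hx : 0 ≤ x) :
    HasDerivAt (remainderAuxDeriv s e) (remainderAuxDeriv2 s e x) x := by
  have h := ((hasDerivAt_one_add_rpow (s - 1) hx).const_mul s).sub
    (hasDerivAt_cubic s (s * (s - 1)) (3 * e) 0 x)
  have hs : s - 1 - 1 = s - 2 := by ring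
  rw [hs] at h
  exact (h.congr_deriv (by simp only [remainderAuxDeriv2]; ring)).congr_of_eventuallyEq
    (.of_forall fun y => by simp [remainderAuxDeriv])

theorem hasDerivAt_remainderAuxInt {s : ℝ} (hs : 0 < s) (e : ℝ) {x : ℝ} (hx : 0 ≤ x) :
    HasDerivAt (remainderAuxInt s e) (remainderAux s e x) x := by
  have h := (((hasDerivAt_one_add_rpow (s + 1) hx).sub_const 1).div_const (s + 1)).sub
    ((hasDerivAt_cubic 0 1 (s / 2) (s * (s - 1) / 6) x).add
      ((hasDerivAt_pow 4 x).const_mul (e / 4)))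
  rw [add_sub_cancel_right] at h
  exact (h.congr_deriv (by
    simp only [remainderAux]; push_cast; field_simp; ring)).congr_of_eventuallyEq
    (.of_forall fun y => by simp [remainderAuxInt])

section

variable {s : ℝ}

theorem remainderAuxDeriv2_pos (h0 : 0 < s) (h1 : s < 1) {x : ℝ} (hx : 0 < x) :
    0 < remainderAuxDeriv2 s 0 x := by
  have h : (1 + x) ^ (s - 2) < 1 :=
    Real.rpow_lt_one_of_one_lt_of_neg (by linarith) (by linarith)
  have := mul_pos (mul_pos h0 (sub_pos.2 h1)) (sub_pos.2 h)
  simp only [remainderAuxDeriv2]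
  linarith

theorem remainderAuxDeriv_pos (h0 : 0 < s) (h1 : s < 1) {x : ℝ} (hx : 0 < x) :
    0 < remainderAuxDeriv s 0 x :=
  pos_of_hasDerivAt_pos (remainderAuxDeriv_zero s 0)
    (fun _ => hasDerivAt_remainderAuxDeriv s 0) (fun _ => remainderAuxDeriv2_pos h0 h1) hx

theorem remainderAux_pos (h0 : 0 < s) (h1 : s < 1) {x : ℝ} (hx : 0 < x) :
    0 < remainderAux s 0 x :=
  pos_of_hasDerivAt_pos (remainderAux_zero s 0)
    (fun _ => hasDerivAt_remainderAux s 0) (fun _ => remainderAuxDeriv_pos h0 h1) hx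

theorem remainderAuxInt_pos (h0 : 0 < s) (h1 : s < 1) {x : ℝ} (hx : 0 < x) :
    0 < remainderAuxInt s 0 x :=
  pos_of_hasDerivAt_pos (remainderAuxInt_zero s 0)
    (fun _ => hasDerivAt_remainderAuxInt h0 0) (fun _ => remainderAux_pos h0 h1) hx

theorem remainderAuxInt_lt_mul_remainderAux (h0 : 0 < s) (h1 : s < 1) {x : ℝ} (hx : 0 < x) :
    3 / 2 * remainderAuxInt s 0 x < x * remainderAux s 0 x := by
  have hderiv : ∀ y, 0 < y → 0 < y * remainderAuxDeriv s 0 y - 1 / 2 * remainderAux s 0 y :=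
    fun y hy => pos_of_hasDerivAt_pos
      (F := fun y => y * remainderAuxDeriv s 0 y - 1 / 2 * remainderAux s 0 y)
      (by simp [remainderAux_zero])
      (fun z hz => ((hasDerivAt_id' z).mul (hasDerivAt_remainderAuxDeriv s 0 hz)).sub
        ((hasDerivAt_remainderAux s 0 hz).const_mul (1 / 2)))
      (fun z hz => by
        have := remainderAuxDeriv_pos h0 h1 hz
        have := mul_pos hz (remainderAuxDeriv2_pos h0 h1 hz)
        linarith) hy
  have := pos_of_hasDerivAt_pos
    (F := fun y => y * remainderAux s 0 y - 3 / 2 * remainderAuxInt s 0 y)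
    (by simp [remainderAuxInt_zero])
    (fun z hz => ((hasDerivAt_id' z).mul (hasDerivAt_remainderAux s 0 hz)).sub
      ((hasDerivAt_remainderAuxInt h0 0 hz).const_mul (3 / 2)))
    (fun z hz => by have := hderiv z hz; linarith) hx
  linarith

theorem one_add_mul_lt_one_add_rpow_of_neg {p : ℝ} (hp : p < 0) {x : ℝ} (hx : 0 < x) :
    1 + p * x < (1 + x) ^ p := by
  have := pos_of_hasDerivAt_pos
    (F := fun y => (1 + y) ^ p - (1 + p * y + 0 * y ^ 2 + 0 * y ^ 3)) (by simp)
    (fun z hz => (hasDerivAt_one_add_rpow p hz).sub (hasDerivAt_cubic 1 p 0 0 z))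
    (fun z hz => by
      have h : (1 + z) ^ (p - 1) < 1 :=
        Real.rpow_lt_one_of_one_lt_of_neg (by linarith) (by linarith)
      have := mul_pos_of_neg_of_neg hp (sub_neg.2 h)
      linarith) hx
  linarith

theorem remainderAuxDeriv2_neg (h0 : 0 < s) (h1 : s < 1) {x : ℝ} (hx : 0 < x) :
    remainderAuxDeriv2 s (s * (s - 1) * (s - 2) / 6) x < 0 := by
  have h := one_add_mul_lt_one_add_rpow_of_neg (p := s - 2) (by linarith) hx
  have := mul_pos (mul_pos h0 (sub_pos.2 h1)) (sub_pos.2 h)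
  simp only [remainderAuxDeriv2]
  linarith

theorem mul_remainderAux_lt_remainderAuxInt (h0 : 0 < s) (h1 : s < 1) {x : ℝ} (hx : 0 < x) :
    x * remainderAux s (s * (s - 1) * (s - 2) / 6) x
      < 2 * remainderAuxInt s (s * (s - 1) * (s - 2) / 6) x := by
  set e := s * (s - 1) * (s - 2) / 6 with he
  have hderiv : ∀ y, 0 < y → 0 < remainderAux s e y - y * remainderAuxDeriv s e y :=
    fun y hy => pos_of_hasDerivAt_pos
      (F := fun y => remainderAux s e y - y * remainderAuxDeriv s e y)
      (by simp [remainderAux_zero])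
      (fun z hz => (hasDerivAt_remainderAux s e hz).sub
        ((hasDerivAt_id' z).mul (hasDerivAt_remainderAuxDeriv s e hz)))
      (fun z hz => by
        have := mul_pos hz (neg_pos.2 (remainderAuxDeriv2_neg h0 h1 hz))
        rw [← he] at this
        linarith) hy
  have := pos_of_hasDerivAt_pos
    (F := fun y => 2 * remainderAuxInt s e y - y * remainderAux s e y)
    (by simp [remainderAuxInt_zero])
    (fun z hz => ((hasDerivAt_remainderAuxInt h0 e hz).const_mul 2).sub
      ((hasDerivAt_id' z).mul (hasDerivAt_remainderAux s e hz)))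
    (fun z hz => by have := hderiv z hz; linarith) hx
  linarith

end

/-- The combination of powers in `M` and `M + M * t`, expanded to third order in `t`. -/
theorem rpow_combination_eq {s M t : ℝ} (hs : 0 < s) (hM : 0 < M) (ht : 0 < t)
    (a1 a2 a3 e : ℝ) :
    (s + 1) * (a1 * M ^ s + a2 * (M + M * t) ^ s)
        + a3 * (M ^ (s + 1) - (M + M * t) ^ (s + 1))
      = (s + 1) * M ^ s * (a1 + a2 - a3 * (M * t)
          + s * (a2 - a3 * (M * t) / 2) * t
          + s * (s - 1) / 2 * (a2 - a3 * (M * t) / 3) * t ^ 2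
          + e * (a2 - a3 * (M * t) / 4) * t ^ 3
          + (a2 * remainderAux s e t - a3 * M * remainderAuxInt s e t)) := by
  have hfac : M + M * t = M * (1 + t) := by ring
  have h1t : 0 < 1 + t := by positivity
  simp only [remainderAux, remainderAuxInt]
  rw [hfac, Real.mul_rpow hM.le h1t.le, Real.mul_rpow hM.le h1t.le, Real.rpow_add_one hM.ne',
    Real.rpow_add_one h1t.ne']
  field_simp
  ring

theorem genBinom_one (s : ℝ) : genBinom s 1 = s := by simp [genBinom]

theorem genBinom_two (s : ℝ) : genBinom s 2 = s * (s - 1) / 2 := by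
  simp [genBinom, Finset.prod_range_succ]

theorem stmt19 (ν M b a1 a2 a3 : ℝ) (hν : ν ∈ Set.Ioo (0:ℝ) 1) (hb : 0 < b) (hbM : b < M) :
    ((a2 < 0 ∧ a3 * b / a2 ≤ 3 / 2) →
      ((2 - ν) * (a1 * M ^ (1 - ν) + a2 * (M + b) ^ (1 - ν))
          + a3 * (M ^ (2 - ν) - (M + b) ^ (2 - ν))
        < (2 - ν) * M ^ (1 - ν) * (a1 + a2 - a3 * b
            + ∑ k ∈ Finset.Icc 1 2,
                genBinom (1 - ν) k * (a2 - a3 * b / ((k : ℝ) + 1)) * (b / M) ^ k))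
      ∧ (2 - ν) * M ^ (1 - ν) * (a1 + a2 - a3 * b
            + ∑ k ∈ Finset.Icc 1 2,
                genBinom (1 - ν) k * (a2 - a3 * b / ((k : ℝ) + 1)) * (b / M) ^ k)
        < (2 - ν) * M ^ (1 - ν) * (a1 + a2 - a3 * b))
    ∧ ((a3 * b = 2 * a2 ∧ 0 < a2) →
      (2 - ν) * (a1 * M ^ (1 - ν) + a2 * (M + b) ^ (1 - ν))
          + a3 * (M ^ (2 - ν) - (M + b) ^ (2 - ν))
        < (2 - ν) * M ^ (1 - ν) * (a1 + a2 - a3 * b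
            - a2 * (b / M) ^ 2 * ((1 - ν) * ν / 6) * (1 - ((ν + 1) / 2) * (b / M)))) := by
  obtain ⟨hν0, hν1⟩ := hν
  have hM : 0 < M := hb.trans hbM
  obtain ⟨s, rfl⟩ : ∃ s, ν = 1 - s := ⟨1 - ν, by ring⟩
  obtain ⟨t, rfl⟩ : ∃ t, b = M * t := ⟨b / M, by field_simp⟩
  have ht : 0 < t := pos_of_mul_pos_right hb hM.le
  have ht1 : t < 1 := by
    by_contra! h
    linarith [mul_le_mul_of_nonneg_left h hM.le]
  have hs0 : 0 < s := by linarith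
  have hs1 : s < 1 := by linarith
  have hX : 0 < (s + 1) * M ^ s := by positivity
  have e1 : 1 - (1 - s) = s := by ring
  have e2 : 2 - (1 - s) = s + 1 := by ring
  have e3 : M * t / M = t := by field_simp
  have hsum : ∑ k ∈ Finset.Icc 1 2,
      genBinom s k * (a2 - a3 * (M * t) / ((k : ℝ) + 1)) * t ^ k
        = s * (a2 - a3 * (M * t) / 2) * t
          + s * (s - 1) / 2 * (a2 - a3 * (M * t) / 3) * t ^ 2 := by
    rw [show Finset.Icc 1 2 = ({1, 2} : Finset ℕ) from rfl, Finset.sum_pair (by norm_num),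
      genBinom_one, genBinom_two]
    push_cast
    ring
  rw [e1, e2, e3, hsum]
  refine ⟨fun ⟨ha2, hγ⟩ => ?_, fun ⟨hγ, ha2⟩ => ?_⟩
  · have hc : 3 / 2 * a2 ≤ a3 * (M * t) := (div_le_iff_of_neg ha2).1 hγ
    constructor
    · rw [rpow_combination_eq hs0 hM ht a1 a2 a3 0]
      refine mul_lt_mul_of_pos_left ?_ hX
      have hneg : a2 * remainderAux s 0 t - a3 * M * remainderAuxInt s 0 t < 0 := by
        refine neg_of_mul_neg_right (a := t) ?_ ht.le
        have h1 := mul_lt_mul_of_neg_left (remainderAuxInt_lt_mul_remainderAux hs0 hs1 ht) ha2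
        have h2 := mul_le_mul_of_nonneg_right hc (remainderAuxInt_pos hs0 hs1 ht).le
        linarith
      linarith
    · refine mul_lt_mul_of_pos_left ?_ hX
      have hfac : a2 - a3 * (M * t) / 2 + (s - 1) / 2 * t * (a2 - a3 * (M * t) / 3) < 0 := by
        have hθ : 0 < 1 - (1 - s) * t := by nlinarith
        have h3 : a2 - a3 * (M * t) / 3 < 0 := by linarith
        have h4 := mul_neg_of_pos_of_neg hθ h3
        linarith
      have := mul_neg_of_pos_of_neg (mul_pos hs0 ht) hfac
      linarith
  · rw [rpow_combination_eq hs0 hM ht a1 a2 a3 (s * (s - 1) * (s - 2) / 6)]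
    refine mul_lt_mul_of_pos_left ?_ hX
    have hneg : a2 * remainderAux s (s * (s - 1) * (s - 2) / 6) t
        - a3 * M * remainderAuxInt s (s * (s - 1) * (s - 2) / 6) t < 0 := by
      refine neg_of_mul_neg_right (a := t) ?_ ht.le
      have h1 := mul_lt_mul_of_pos_left (mul_remainderAux_lt_remainderAuxInt hs0 hs1 ht) ha2
      have h2 : a3 * (M * t) * remainderAuxInt s (s * (s - 1) * (s - 2) / 6) t
          = 2 * a2 * remainderAuxInt s (s * (s - 1) * (s - 2) / 6) t := by rw [hγ]
      linarith
    rw [hγ]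
    linarith
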